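/- Let (X,T) be a topological dynamical system and Λ = {a_1,…,a_ℓ} a collection of sequences of positive integers. A closed subset E of X with at least two points is Δ-weakly mixing along Λ if and only if there exists an increasing sequence of Cantor sets C_1 ⊆ C_2 ⊆ ⋯ contained in E such that C := ⋃_{k=1}^{∞} C_k is dense in E and: (1) for any subset A of C and any continuous functions g_1,…,g_ℓ : A → E, there exists an increasing sequence (p_n) of positive integers such that lim_{n→∞} T^{a_j(p_n)}x = g_j(x) for every x ∈ A and every j = 1,…,ℓ; (2) for any k ∈ ℕ, any closed subset B of C_k, and any continuous functions h_1,…,h_ℓ : B → E, there exists an increasing sequence (q_n) of positive integers such that T^{a_j(q_n)}x → h_j(x) as n → ∞, uniformly in x ∈ B and j = 1,…,ℓ. -/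

import Mathlib

open MeasureTheory Filter Topology Set

/-- `E` is Δ-transitive along the collection `a` of sequences: there is a residual subset
`A` of `E` (in the subspace topology) such that for every `x ∈ A`,
`E^ℓ ⊆ closure {(T^{a₁(n)}x, …, T^{a_ℓ(n)}x) : n ∈ ℕ}`. -/
def DeltaTransAlong {X : Type*} [TopologicalSpace X] {ℓ : ℕ} (T : X → X)
    (a : Fin ℓ → ℕ → ℕ) (E : Set X) : Prop :=
  ∃ A ∈ residual ↥E, ∀ x ∈ A,
    {y : Fin ℓ → X | ∀ i, y i ∈ E} ⊆
      closure {y : Fin ℓ → X | ∃ n : ℕ, 1 ≤ n ∧ y = fun i => T^[a i n] (x : X)}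

/-- `E` is Δ-weakly mixing along the collection `a` of sequences: for every `m ∈ ℕ`, the set
`E^m` is a Δ-transitive subset of the product system `(X^m, T × ⋯ × T)` along `a`. -/
def DeltaWeakMixAlong {X : Type*} [TopologicalSpace X] {ℓ : ℕ} (T : X → X)
    (a : Fin ℓ → ℕ → ℕ) (E : Set X) : Prop :=
  ∀ m : ℕ, 1 ≤ m →
    DeltaTransAlong (fun y : Fin m → X => T ∘ y) a {y : Fin m → X | ∀ j, y j ∈ E}

/-- A Cantor set: a non-empty compact perfect totally disconnected set. -/
def IsCantorSet {X : Type*} [TopologicalSpace X] (C : Set X) : Prop :=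
  C.Nonempty ∧ IsCompact C ∧ Perfect C ∧ IsTotallyDisconnected C

theorem Preperfect.infinite_inter {X : Type*} [TopologicalSpace X] [T1Space X] {S U : Set X}
    (hS : Preperfect S) (hU : IsOpen U) (hne : (U ∩ S).Nonempty) : (U ∩ S).Infinite := by
  obtain ⟨x, hx⟩ := hne
  exact Set.Infinite.of_accPt (hS.open_inter hU x hx)

/-- Infinite sets indexed by a finite type admit an injective choice of points. -/
theorem exists_injective_mem_of_infinite {ι X : Type*} [Finite ι] (S : ι → Set X)
    (hS : ∀ s, (S s).Infinite) : ∃ x : ι → X, Function.Injective x ∧ ∀ s, x s ∈ S s := by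
  classical
  have := Fintype.ofFinite ι
  choose t hts htc using fun s => (hS s).exists_subset_card_eq (Fintype.card ι)
  obtain ⟨x, hx, hxt⟩ := (Finset.all_card_le_biUnion_card_iff_exists_injective t).1 (by
    intro A
    rcases A.eq_empty_or_nonempty with rfl | ⟨s, hs⟩
    · simp
    · calc A.card ≤ Fintype.card ι := Finset.card_le_univ A
        _ = (t s).card := (htc s).symm
        _ ≤ (A.biUnion t).card := Finset.card_le_card (Finset.subset_biUnion_of_mem t hs))
  exact ⟨x, hx, fun s => hts s (hxt s)⟩

theorem iterate_comp_left_apply {ι X : Type*} (T : X → X) (k : ℕ) (x : ι → X) :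
    (fun y : ι → X => T ∘ y)^[k] x = fun s => T^[k] (x s) := by
  induction k generalizing x with
  | zero => rfl
  | succ k ih =>
    rw [Function.iterate_succ_apply, ih]
    rfl

section Forward

variable {ℓ : ℕ} {a : Fin ℓ → ℕ → ℕ} {X : Type*} [MetricSpace X] {T : X → X} {E : Set X}

/-- In a Δ-weakly mixing set, some tuple of points in prescribed open sets visits every
prescribed family of open sets at a common time. -/
theorem DeltaWeakMixAlong.exists_transitive_point [CompactSpace X] (hW : DeltaWeakMixAlong T a E)
    (hE : IsClosed E) {ι : Type*} [Finite ι] [Nonempty ι] (U : ι → Set X)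
    (hU : ∀ s, IsOpen (U s)) (hne : ∀ s, (U s ∩ E).Nonempty) :
    ∃ x : ι → X, (∀ s, x s ∈ U s ∩ E) ∧ ∀ V : Fin ℓ → ι → Set X, (∀ i s, IsOpen (V i s)) →
      (∀ i s, (V i s ∩ E).Nonempty) → ∃ n, 1 ≤ n ∧ ∀ i s, T^[a i n] (x s) ∈ V i s := by
  have := Fintype.ofFinite ι
  let e := Fintype.equivFin ι
  obtain ⟨A, hA, hAt⟩ := hW (Fintype.card ι) Fintype.card_pos
  set Em : Set (Fin (Fintype.card ι) → X) := {y | ∀ j, y j ∈ E} with hEm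
  have hEmc : IsClosed Em := by
    have : Em = Set.univ.pi fun _ => E := by ext; simp [hEm]
    rw [this]
    exact isClosed_set_pi fun _ _ => hE
  have : CompactSpace Em := isCompact_iff_compactSpace.1 hEmc.isCompact
  let O : Set Em := {y | ∀ j, (y : Fin (Fintype.card ι) → X) j ∈ U (e.symm j)}
  have hO : IsOpen O := by
    have : O = ⋂ j, (fun y : Em => (y : Fin (Fintype.card ι) → X) j) ⁻¹' (U (e.symm j)) := by
      ext; simp [O]
    rw [this]
    exact isOpen_iInter_of_finite fun j => (hU _).preimage
      ((continuous_apply j).comp continuous_subtype_val)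
  choose u hu using hne
  obtain ⟨y, hyO, hyA⟩ := (dense_of_mem_residual hA).inter_open_nonempty O hO
    ⟨⟨fun j => u (e.symm j), fun j => (hu _).2⟩, fun j => (hu _).1⟩
  refine ⟨fun s => y.1 (e s), fun s => ⟨by simpa using hyO (e s), y.2 (e s)⟩, ?_⟩
  intro V hV hVne
  choose v hv using hVne
  have hmem := hAt y hyA (show (fun i j => v i (e.symm j)) ∈ _ from fun i j => (hv _ _).2)
  have hopen : IsOpen {w : Fin ℓ → Fin (Fintype.card ι) → X | ∀ i j, w i j ∈ V i (e.symm j)} := by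
    have : {w : Fin ℓ → Fin (Fintype.card ι) → X | ∀ i j, w i j ∈ V i (e.symm j)} =
        ⋂ i, ⋂ j, (fun w : Fin ℓ → Fin (Fintype.card ι) → X => w i j) ⁻¹' (V i (e.symm j)) := by
      ext; simp
    rw [this]
    exact isOpen_iInter_of_finite fun i => isOpen_iInter_of_finite fun j =>
      (hV _ _).preimage (by fun_prop)
  obtain ⟨w, hw, n, hn, rfl⟩ := mem_closure_iff.1 hmem _ hopen fun i j => (hv _ _).1
  refine ⟨n, hn, fun i s => ?_⟩
  simpa [iterate_comp_left_apply] using hw i (e s)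

theorem DeltaWeakMixAlong.preperfect [CompactSpace X] (hW : DeltaWeakMixAlong T a E) (hℓ : 1 ≤ ℓ)
    (hE : IsClosed E) (hnt : E.Nontrivial) : Preperfect E := by
  rw [preperfect_iff_nhds]
  intro e he O hO
  by_contra! hiso
  obtain ⟨U, hUO, hU, heU⟩ := mem_nhds_iff.1 hO
  obtain ⟨x, hx, hxV⟩ := hW.exists_transitive_point hE (fun _ : Bool => U) (fun _ => hU)
    (fun _ => ⟨e, heU, he⟩)
  have hxe : ∀ b, x b = e := fun b => hiso _ ⟨hUO (hx b).1, (hx b).2⟩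
  obtain ⟨e₁, he₁, e₂, he₂, hne⟩ := hnt
  obtain ⟨V, W, hV, hWo, h1, h2, hd⟩ := t2_separation hne
  obtain ⟨n, -, hn⟩ := hxV (fun _ b => if b then V else W)
    (fun _ b => by cases b <;> simp [hV, hWo])
    (fun _ b => by
      cases b
      · exact ⟨e₂, by simpa using h2, he₂⟩
      · exact ⟨e₁, by simpa using h1, he₁⟩)
  have ht := hn ⟨0, hℓ⟩ true
  have hf := hn ⟨0, hℓ⟩ false
  simp only [hxe, if_true, Bool.false_eq_true, if_false] at ht hf
  exact Set.disjoint_left.1 hd ht hf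

/-- In a Δ-weakly mixing set, visits to prescribed open sets occur at arbitrarily late times. -/
theorem DeltaWeakMixAlong.exists_late_visit [CompactSpace X]
    (hW : DeltaWeakMixAlong T a E) (hℓ : 1 ≤ ℓ)
    (hE : IsClosed E) (hnt : E.Nontrivial) {ι : Type*} [Finite ι] (N : ℕ) (U : ι → Set X)
    (hU : ∀ s, IsOpen (U s)) (hne : ∀ s, (U s ∩ E).Nonempty) (V : Fin ℓ → ι → Set X)
    (hV : ∀ i s, IsOpen (V i s)) (hVne : ∀ i s, (V i s ∩ E).Nonempty) :
    ∃ x : ι → X, (∀ s, x s ∈ U s ∩ E) ∧ ∃ n, N < n ∧ ∀ i s, T^[a i n] (x s) ∈ V i s := by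
  rcases isEmpty_or_nonempty ι with hι | ⟨⟨s₀⟩⟩
  · exact ⟨fun s => hι.elim s, fun s => hι.elim s, N + 1, N.lt_succ_self, fun _ s => hι.elim s⟩
  have : Nonempty ι := ⟨s₀⟩
  obtain ⟨x, hx, hxV⟩ := hW.exists_transitive_point hE U hU hne
  let i₀ : Fin ℓ := ⟨0, hℓ⟩
  let Q : Set X := (fun n => T^[a i₀ n] (x s₀)) '' Set.Iic N
  have hQ : Q.Finite := (Set.finite_Iic N).image _
  obtain ⟨n, -, hn⟩ := hxV (fun i s => V i s \ Q) (fun i s => (hV i s).sdiff hQ.isClosed)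
    (fun i s => by
      have := ((hW.preperfect hℓ hE hnt).infinite_inter (hV i s) (hVne i s)).sdiff hQ
      obtain ⟨z, hz, hzQ⟩ := this.nonempty
      exact ⟨z, ⟨hz.1, hzQ⟩, hz.2⟩)
  refine ⟨x, hx, n, ?_, fun i s => (hn i s).1⟩
  by_contra! hle
  exact (hn i₀ s₀).2 ⟨n, hle, rfl⟩

/-- Open sets meeting a Δ-weakly mixing set can be shrunk so that each of finitely many
prescribed target patterns is approximated on them at a late time. -/
theorem DeltaWeakMixAlong.exists_shrinking [CompactSpace X]
    (hW : DeltaWeakMixAlong T a E) (hT : Continuous T)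
    (hℓ : 1 ≤ ℓ) (hE : IsClosed E) (hnt : E.Nontrivial) {ι : Type*} [Finite ι] (N : ℕ) {ε : ℝ}
    (hε : 0 < ε) (O : ι → Set X) (hO : ∀ s, IsOpen (O s)) (hne : ∀ s, (O s ∩ E).Nonempty)
    {R : Set (Fin ℓ → ι → X)} (hR : R.Finite) (hRE : ∀ f ∈ R, ∀ i s, f i s ∈ E) :
    ∃ U : ι → Set X, (∀ s, IsOpen (U s)) ∧ (∀ s, U s ⊆ O s) ∧ (∀ s, (U s ∩ E).Nonempty) ∧
      ∀ f ∈ R, ∃ p, N < p ∧ ∀ i s, ∀ z ∈ U s, dist (T^[a i p] z) (f i s) < ε := by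
  induction R, hR using Set.Finite.induction_on with
  | empty => exact ⟨O, hO, fun _ => subset_rfl, hne, by simp⟩
  | @insert f R hfR hR ih =>
    obtain ⟨U, hU, hUO, hUne, hUR⟩ := ih fun g hg => hRE g (Set.mem_insert_of_mem _ hg)
    have hfE := hRE f (Set.mem_insert _ _)
    obtain ⟨x, hx, p, hp, hxp⟩ := hW.exists_late_visit hℓ hE hnt N U hU hUne
      (fun i s => Metric.ball (f i s) ε) (fun _ _ => Metric.isOpen_ball)
      (fun i s => ⟨f i s, Metric.mem_ball_self hε, hfE i s⟩)
    refine ⟨fun s => U s ∩ ⋂ i, T^[a i p] ⁻¹' Metric.ball (f i s) ε, fun s => ?_, fun s => ?_,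
      fun s => ?_, ?_⟩
    · exact (hU s).inter (isOpen_iInter_of_finite fun i =>
        Metric.isOpen_ball.preimage (hT.iterate _))
    · exact Set.inter_subset_left.trans (hUO s)
    · exact ⟨x s, ⟨(hx s).1, Set.mem_iInter.2 fun i => hxp i s⟩, (hx s).2⟩
    · rintro g (rfl | hg)
      · exact ⟨p, hp, fun i s z hz => Set.mem_iInter.1 hz.2 i⟩
      · obtain ⟨q, hq, hqz⟩ := hUR g hg
        exact ⟨q, hq, fun i s z hz => hqz i s z hz.1⟩

/-- Consecutive stages of a Cantor scheme: the stage with centres `Q` and radius `ρ` refines the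
stage with centres `P` and radius `r`, is `4δ`-dense in `E`, and up to `2δ` every assignment of
targets in `E` to its cells is realized at a time later than `N`. -/
structure CellRefinement (T : X → X) (a : Fin ℓ → ℕ → ℕ) (E : Set X) (N : ℕ) (δ : ℝ)
    (P : Finset X) (r : ℝ) (Q : Finset X) (ρ : ℝ) : Prop where
  disjoint : ∀ x ∈ Q, ∀ y ∈ Q, x ≠ y →
    Disjoint (Metric.closedBall x ρ) (Metric.closedBall y ρ)
  split : ∀ x ∈ P, ∃ y ∈ Q, ∃ z ∈ Q, y ≠ z ∧
    Metric.closedBall y ρ ⊆ Metric.closedBall x r ∧ Metric.closedBall z ρ ⊆ Metric.closedBall x r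
  nested : ∀ y ∈ Q, (∃ x ∈ P, Metric.closedBall y ρ ⊆ Metric.closedBall x r) ∨
    ∀ x ∈ P, Disjoint (Metric.closedBall y ρ) (Metric.closedBall x r)
  dense : ∀ e ∈ E, ∃ y ∈ Q, dist e y ≤ 4 * δ
  realize : ∀ f : Fin ℓ → X → X, (∀ i, ∀ y ∈ Q, f i y ∈ E) → ∃ p, N < p ∧
    ∀ i, ∀ y ∈ Q, ∀ z ∈ Metric.closedBall y ρ, dist (T^[a i p] z) (f i y) < 2 * δ

theorem DeltaWeakMixAlong.exists_cellRefinement [CompactSpace X] (hW : DeltaWeakMixAlong T a E)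
    (hT : Continuous T) (hℓ : 1 ≤ ℓ) (hE : IsClosed E) (hnt : E.Nontrivial) (N : ℕ) {δ η : ℝ}
    (hδ : 0 < δ) (hη : 0 < η) {P : Finset X} {r : ℝ} (hP : ∀ x ∈ P, x ∈ E) (hr : 0 < r)
    (hrδ : r ≤ δ) :
    ∃ (Q : Finset X) (ρ : ℝ), (∀ x ∈ Q, x ∈ E) ∧ 0 < ρ ∧ ρ ≤ η ∧
      CellRefinement T a E N δ P r Q ρ := by
  classical
  obtain ⟨F, hFE, hF, hcov⟩ := hE.isCompact.finite_cover_balls hδ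
  have hnet : ∀ e ∈ E, ∃ c ∈ F, dist e c < δ := fun e he => by simpa using hcov he
  have := hF.to_subtype
  let ι := (↥P × Bool) ⊕ {e : ↥F // ∀ x ∈ P, r < dist (e : X) x}
  let O : ι → Set X := Sum.elim (fun s => Metric.ball s.1.1 r)
    (fun e => Metric.ball e.1.1 δ ∩ ⋂ x ∈ P, (Metric.closedBall x r)ᶜ)
  have hO : ∀ s, IsOpen (O s) := by
    rintro (s | e)
    · exact Metric.isOpen_ball
    · exact Metric.isOpen_ball.inter
        (isOpen_biInter_finset fun x _ => Metric.isClosed_closedBall.isOpen_compl)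
  have hOne : ∀ s, (O s ∩ E).Nonempty := by
    rintro (s | e)
    · exact ⟨s.1.1, Metric.mem_ball_self hr, hP _ s.1.2⟩
    · refine ⟨e.1.1, ⟨Metric.mem_ball_self hδ, ?_⟩, hFE e.1.2⟩
      simpa using e.2
  have hR : {f : Fin ℓ → ι → X | ∀ i, f i ∈ {g : ι → X | ∀ s, g s ∈ F}}.Finite :=
    Set.Finite.pi' fun _ => Set.Finite.pi' fun _ => hF
  obtain ⟨U, hU, hUO, hUne, hUR⟩ := hW.exists_shrinking hT hℓ hE hnt N hδ O hO hOne hR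
    (fun f hf i s => hFE (hf i s))
  obtain ⟨x, hxinj, hx⟩ := exists_injective_mem_of_infinite (fun s => U s ∩ E)
    fun s => (hW.preperfect hℓ hE hnt).infinite_inter (hU s) (hUne s)
  have hball : ∀ s, ∀ᶠ ρ in 𝓝[>] (0 : ℝ), Metric.closedBall (x s) ρ ⊆ U s := by
    intro s
    obtain ⟨t, ht, hts⟩ := Metric.nhds_basis_closedBall.mem_iff.1 ((hU s).mem_nhds (hx s).1)
    filter_upwards [Ioc_mem_nhdsGT ht] with ρ hρ
    exact (Metric.closedBall_subset_closedBall hρ.2).trans hts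
  have hdisj : ∀ s t, ∀ᶠ ρ in 𝓝[>] (0 : ℝ), s ≠ t →
      Disjoint (Metric.closedBall (x s) ρ) (Metric.closedBall (x t) ρ) := by
    intro s t
    rcases eq_or_ne s t with h | h
    · simp [h]
    have hd : 0 < dist (x s) (x t) / 2 := half_pos (dist_pos.2 (hxinj.ne h))
    filter_upwards [Ioo_mem_nhdsGT hd] with ρ hρ _
    exact Metric.closedBall_disjoint_closedBall (by linarith [hρ.2])
  obtain ⟨ρ, hρb, hρd, hρ⟩ := ((Filter.eventually_all.2 hball).and
    ((Filter.eventually_all.2 fun s => Filter.eventually_all.2 (hdisj s)).and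
      (Ioc_mem_nhdsGT hη))).exists
  have hsub : ∀ s, Metric.closedBall (x s) ρ ⊆ O s := fun s => (hρb s).trans (hUO s)
  have := Fintype.ofFinite ι
  have hchild : ∀ (c : ↥P) (b : Bool),
      Metric.closedBall (x (Sum.inl (c, b))) ρ ⊆ Metric.closedBall c.1 r := fun c b =>
    (hsub (Sum.inl (c, b))).trans Metric.ball_subset_closedBall
  refine ⟨Finset.univ.image x, ρ, by simpa using fun s => (hx s).2, hρ.1, hρ.2, ?_, ?_, ?_, ?_, ?_⟩
  · simp only [Finset.mem_image, Finset.mem_univ, true_and]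
    rintro _ ⟨s, rfl⟩ _ ⟨t, rfl⟩ hst
    exact hρd s t (fun h => hst (h ▸ rfl))
  · intro c hc
    exact ⟨x (Sum.inl (⟨c, hc⟩, true)), by simp, x (Sum.inl (⟨c, hc⟩, false)), by simp,
      hxinj.ne fun h => by simpa using Sum.inl_injective h,
      hchild ⟨c, hc⟩ true, hchild ⟨c, hc⟩ false⟩
  · simp only [Finset.mem_image, Finset.mem_univ, true_and]
    rintro _ ⟨⟨c, b⟩ | e, rfl⟩
    · exact Or.inl ⟨c, c.2, hchild c b⟩
    · right
      intro c hc
      rw [Set.disjoint_left]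
      intro z hz hzc
      exact Set.mem_iInter₂.1 (hsub _ hz).2 c hc hzc
  · intro e he
    obtain ⟨c, hcF, hc⟩ := hnet e he
    by_cases hcP : ∀ y ∈ P, r < dist c y
    · refine ⟨x (Sum.inr ⟨⟨c, hcF⟩, hcP⟩), by simp, ?_⟩
      have h1 := (hsub (Sum.inr ⟨⟨c, hcF⟩, hcP⟩) (Metric.mem_closedBall_self hρ.1.le)).1
      have h2 : dist (x (Sum.inr ⟨⟨c, hcF⟩, hcP⟩)) c < δ := h1
      rw [dist_comm] at h2
      linarith [dist_triangle e c (x (Sum.inr ⟨⟨c, hcF⟩, hcP⟩))]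
    · push Not at hcP
      obtain ⟨y, hy, hcy⟩ := hcP
      refine ⟨x (Sum.inl (⟨y, hy⟩, true)), by simp, ?_⟩
      have h1 : dist (x (Sum.inl (⟨y, hy⟩, true))) y ≤ r :=
        hchild ⟨y, hy⟩ true (Metric.mem_closedBall_self hρ.1.le)
      rw [dist_comm] at h1
      linarith [dist_triangle4 e c y (x (Sum.inl (⟨y, hy⟩, true)))]
  · intro f hf
    have hfx : ∀ i s, f i (x s) ∈ E := fun i s => hf i _ (by simp)
    choose g hgF hg using fun i s => hnet _ (hfx i s)
    obtain ⟨p, hp, hpz⟩ := hUR g hgF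
    refine ⟨p, hp, ?_⟩
    simp only [Finset.mem_image, Finset.mem_univ, true_and]
    rintro i _ ⟨s, rfl⟩ z hz
    have h1 := hpz i s z (hρb s hz)
    have h2 := hg i s
    rw [dist_comm] at h2
    linarith [dist_triangle (T^[a i p] z) (g i s) (f i (x s))]

/-- A sequence of finite families of closed balls centred in `E`, the `n`-th with centres `P n`
and radius `r n`, each refining the previous one. -/
structure CellSystem (T : X → X) (a : Fin ℓ → ℕ → ℕ) (E : Set X) (P : ℕ → Finset X)
    (r : ℕ → ℝ) : Prop where
  mem : ∀ n, ∀ x ∈ P n, x ∈ E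
  pos : ∀ n, 0 < r n
  le : ∀ n, r n ≤ 1 / ((n : ℝ) + 1)
  refinement : ∀ n, CellRefinement T a E n (1 / ((n : ℝ) + 1)) (P n) (r n) (P (n + 1)) (r (n + 1))

theorem DeltaWeakMixAlong.exists_cellSystem [CompactSpace X] (hW : DeltaWeakMixAlong T a E)
    (hT : Continuous T) (hℓ : 1 ≤ ℓ) (hE : IsClosed E) (hnt : E.Nontrivial) :
    ∃ (P : ℕ → Finset X) (r : ℕ → ℝ), CellSystem T a E P r := by
  let S (n : ℕ) := {s : Finset X × ℝ // (∀ x ∈ s.1, x ∈ E) ∧ 0 < s.2 ∧ s.2 ≤ 1 / ((n : ℝ) + 1)}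
  have hstep : ∀ (n : ℕ) (s : S n), ∃ t : S (n + 1),
      CellRefinement T a E n (1 / ((n : ℝ) + 1)) s.1.1 s.1.2 t.1.1 t.1.2 := by
    intro n s
    obtain ⟨Q, ρ, hQ, hρ, hρη, h⟩ := hW.exists_cellRefinement hT hℓ hE hnt n
      (δ := 1 / ((n : ℝ) + 1)) (η := 1 / (((n + 1 : ℕ) : ℝ) + 1)) (by positivity) (by positivity)
      s.2.1 s.2.2.1 s.2.2.2
    exact ⟨⟨(Q, ρ), hQ, hρ, hρη⟩, h⟩
  choose next hnext using hstep
  let seq : ∀ n, S n := fun n => Nat.rec ⟨(∅, 1), by simp, by simp, by simp⟩ next n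
  exact ⟨fun n => (seq n).1.1, fun n => (seq n).1.2, fun n => (seq n).2.1,
    fun n => (seq n).2.2.1, fun n => (seq n).2.2.2, fun n => hnext n (seq n)⟩

namespace CellSystem

variable {P : ℕ → Finset X} {r : ℕ → ℝ}

/-- The union of the cells of one stage. -/
def stage (P : ℕ → Finset X) (r : ℕ → ℝ) (n : ℕ) : Set X := ⋃ x ∈ P n, Metric.closedBall x (r n)

/-- The points of `E` that lie in the cells of all stages later than `k`. -/
def limitSet (E : Set X) (P : ℕ → Finset X) (r : ℕ → ℝ) (k : ℕ) : Set X :=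
  {z | z ∈ E ∧ ∀ n, k < n → z ∈ stage P r n}

theorem mem_stage {n : ℕ} {z : X} :
    z ∈ stage P r n ↔ ∃ x ∈ P n, z ∈ Metric.closedBall x (r n) := by
  simp [stage]

theorem isClosed_stage (n : ℕ) : IsClosed (stage P r n) :=
  isClosed_biUnion_finset fun _ _ => Metric.isClosed_closedBall

theorem isClosed_limitSet (hE : IsClosed E) (k : ℕ) : IsClosed (limitSet E P r k) := by
  have : limitSet E P r k = E ∩ ⋂ n, ⋂ (_ : k < n), stage P r n := by
    ext; simp [limitSet]
  rw [this]
  exact hE.inter (isClosed_iInter fun n => isClosed_iInter fun _ => isClosed_stage n)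

theorem tendsto_radius (h : CellSystem T a E P r) : Tendsto r atTop (𝓝 0) :=
  squeeze_zero (fun n => (h.pos n).le) h.le tendsto_one_div_add_atTop_nhds_zero_nat

/-- Every cell contains a point of `E` that lies in the cells of all later stages. -/
theorem exists_mem_cell [CompactSpace X]
    (h : CellSystem T a E P r) (hE : IsClosed E) {n : ℕ} {x : X}
    (hx : x ∈ P n) :
    ∃ z ∈ E, z ∈ Metric.closedBall x (r n) ∧ ∀ m, n ≤ m → z ∈ stage P r m := by
  have hstep : ∀ (i : ℕ) (y : ↥(P (n + i))), ∃ y' : ↥(P (n + (i + 1))),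
      Metric.closedBall (y' : X) (r (n + (i + 1))) ⊆ Metric.closedBall (y : X) (r (n + i)) := by
    intro i y
    obtain ⟨y', hy', -, -, -, hsub, -⟩ := (h.refinement (n + i)).split y y.2
    exact ⟨⟨y', hy'⟩, hsub⟩
  choose next hnext using hstep
  let seq : ∀ i, ↥(P (n + i)) := fun i => Nat.rec ⟨x, hx⟩ next i
  obtain ⟨z, hz⟩ := IsCompact.nonempty_iInter_of_sequence_nonempty_isCompact_isClosed
    (fun i => Metric.closedBall (seq i).1 (r (n + i)) ∩ E)
    (fun i => Set.inter_subset_inter_left _ (hnext i (seq i)))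
    (fun i => ⟨(seq i).1, Metric.mem_closedBall_self (h.pos _).le, h.mem _ _ (seq i).2⟩)
    (Metric.isClosed_closedBall.inter hE).isCompact
    (fun i => Metric.isClosed_closedBall.inter hE)
  rw [Set.mem_iInter] at hz
  refine ⟨z, (hz 0).2, (hz 0).1, fun m hm => ?_⟩
  obtain ⟨i, rfl⟩ := Nat.exists_eq_add_of_le hm
  exact mem_stage.2 ⟨(seq i).1, (seq i).2, (hz i).1⟩

/-- A cell containing a point of the limit set is contained in all relevant earlier stages. -/
theorem cell_subset_stage (h : CellSystem T a E P r) {k m n : ℕ} (hkm : k < m) (hmn : m ≤ n)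
    {x z : X} (hz : z ∈ limitSet E P r k) (hx : x ∈ P n) (hzx : z ∈ Metric.closedBall x (r n)) :
    Metric.closedBall x (r n) ⊆ stage P r m := by
  induction n, hmn using Nat.le_induction generalizing x with
  | base => exact fun w hw => mem_stage.2 ⟨x, hx, hw⟩
  | succ n hmn ih =>
    obtain ⟨y, hy, hzy⟩ := mem_stage.1 (hz.2 n (hkm.trans_le hmn))
    rcases (h.refinement n).nested x hx with ⟨y', hy', hsub⟩ | hdisj
    · exact hsub.trans (ih hy' (hsub hzx))
    · exact absurd hzy (Set.disjoint_left.1 (hdisj y hy) hzx)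

theorem preperfect_limitSet [CompactSpace X] (h : CellSystem T a E P r) (hE : IsClosed E) (k : ℕ) :
    Preperfect (limitSet E P r k) := by
  rw [preperfect_iff_nhds]
  intro z hz U hU
  obtain ⟨ε, hε, hεU⟩ := Metric.mem_nhds_iff.1 hU
  obtain ⟨n, hn, hkn⟩ := ((h.tendsto_radius.eventually (gt_mem_nhds (half_pos hε))).and
    (eventually_gt_atTop k)).exists
  obtain ⟨x, hx, hzx⟩ := mem_stage.1 (hz.2 n hkn)
  have key : ∃ y ∈ P (n + 1), Metric.closedBall y (r (n + 1)) ⊆ Metric.closedBall x (r n) ∧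
      z ∉ Metric.closedBall y (r (n + 1)) := by
    obtain ⟨y₁, hy₁, y₂, hy₂, hne, h₁, h₂⟩ := (h.refinement n).split x hx
    by_cases hzy : z ∈ Metric.closedBall y₁ (r (n + 1))
    · exact ⟨y₂, hy₂, h₂, Set.disjoint_left.1 ((h.refinement n).disjoint _ hy₁ _ hy₂ hne) hzy⟩
    · exact ⟨y₁, hy₁, h₁, hzy⟩
  obtain ⟨y, hy, hyx, hzy⟩ := key
  obtain ⟨w, hwE, hwy, hw⟩ := h.exists_mem_cell hE hy
  refine ⟨w, ⟨hεU ?_, hwE, fun m hm => ?_⟩, fun hwz => hzy (hwz ▸ hwy)⟩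
  · have h1 : dist w x ≤ r n := hyx hwy
    have h2 : dist z x ≤ r n := hzx
    rw [Metric.mem_ball]
    linarith [dist_triangle_right w z x]
  · rcases le_or_gt m n with hmn | hmn
    · exact h.cell_subset_stage hm hmn hz hx hzx (hyx hwy)
    · exact hw m hmn

theorem isTotallyDisconnected_limitSet (h : CellSystem T a E P r) (k : ℕ) :
    IsTotallyDisconnected (limitSet E P r k) := by
  classical
  intro t ht hpre u hu v hv
  have hdist : ∀ᶠ n in atTop, dist u v ≤ 2 * r (n + 1) := by
    filter_upwards [eventually_ge_atTop k] with n hn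
    obtain ⟨x, hx, hux⟩ := mem_stage.1 ((ht hu).2 (n + 1) (Nat.lt_succ_of_le hn))
    have hcover : t ⊆ Metric.closedBall x (r (n + 1)) ∪
        ⋃ y ∈ (P (n + 1)).erase x, Metric.closedBall y (r (n + 1)) := by
      intro w hw
      obtain ⟨y, hy, hwy⟩ := mem_stage.1 ((ht hw).2 (n + 1) (Nat.lt_succ_of_le hn))
      rcases eq_or_ne y x with rfl | hyx
      · exact Or.inl hwy
      · exact Or.inr (Set.mem_biUnion (Finset.mem_erase.2 ⟨hyx, hy⟩) hwy)
    have hdisj : Disjoint (Metric.closedBall x (r (n + 1)))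
        (⋃ y ∈ (P (n + 1)).erase x, Metric.closedBall y (r (n + 1))) := by
      simp only [Set.disjoint_iUnion_right]
      intro y hy
      exact (h.refinement n).disjoint _ hx _ (Finset.mem_of_mem_erase hy)
        (Finset.ne_of_mem_erase hy).symm
    rcases isPreconnected_iff_subset_of_disjoint_closed.1 hpre _ _ Metric.isClosed_closedBall
      (isClosed_biUnion_finset fun _ _ => Metric.isClosed_closedBall) hcover
      (by rw [hdisj.inter_eq, Set.inter_empty]) with hsub | hsub
    · have h1 : dist u x ≤ r (n + 1) := hux
      have h2 : dist v x ≤ r (n + 1) := hsub hv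
      linarith [dist_triangle_right u v x]
    · exact absurd (hsub hu) (Set.disjoint_left.1 hdisj hux)
  have hlim : Tendsto (fun n => 2 * r (n + 1)) atTop (𝓝 0) := by
    simpa using (h.tendsto_radius.comp (tendsto_add_atTop_nat 1)).const_mul 2
  exact dist_le_zero.1 (ge_of_tendsto hlim hdist)

theorem mem_limitSet_of_mem_cell [CompactSpace X]
    (h : CellSystem T a E P r) (hE : IsClosed E) {k : ℕ} {x : X}
    (hx : x ∈ P (k + 1)) : ∃ z ∈ limitSet E P r k, dist z x ≤ r (k + 1) := by
  obtain ⟨z, hzE, hzx, hz⟩ := h.exists_mem_cell hE hx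
  exact ⟨z, ⟨hzE, hz⟩, hzx⟩

theorem isCantorSet_limitSet [CompactSpace X]
    (h : CellSystem T a E P r) (hE : IsClosed E) (hne : E.Nonempty)
    (k : ℕ) : IsCantorSet (limitSet E P r k) := by
  obtain ⟨e, he⟩ := hne
  obtain ⟨x, hx, -⟩ := (h.refinement k).dense e he
  obtain ⟨z, hz, -⟩ := h.mem_limitSet_of_mem_cell hE hx
  exact ⟨⟨z, hz⟩, (isClosed_limitSet hE k).isCompact,
    ⟨isClosed_limitSet hE k, h.preperfect_limitSet hE k⟩, h.isTotallyDisconnected_limitSet k⟩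

theorem limitSet_mono {k l : ℕ} (hkl : k ≤ l) : limitSet E P r k ⊆ limitSet E P r l :=
  fun _ hz => ⟨hz.1, fun n hn => hz.2 n (hkl.trans_lt hn)⟩

theorem subset_closure_iUnion_limitSet [CompactSpace X]
    (h : CellSystem T a E P r) (hE : IsClosed E) :
    E ⊆ closure (⋃ k, limitSet E P r k) := by
  intro e he
  rw [Metric.mem_closure_iff]
  intro ε hε
  have hlim : Tendsto (fun k : ℕ => 4 * (1 / ((k : ℝ) + 1)) + r (k + 1)) atTop (𝓝 0) := by
    simpa using (tendsto_one_div_add_atTop_nhds_zero_nat (𝕜 := ℝ)).const_mul 4 |>.add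
      (h.tendsto_radius.comp (tendsto_add_atTop_nat 1))
  obtain ⟨k, hk⟩ := (hlim.eventually (gt_mem_nhds hε)).exists
  obtain ⟨x, hx, hex⟩ := (h.refinement k).dense e he
  obtain ⟨z, hz, hzx⟩ := h.mem_limitSet_of_mem_cell hE hx
  exact ⟨z, Set.mem_iUnion.2 ⟨k, hz⟩, by linarith [dist_triangle_right e z x]⟩

/-- For any maps from a set `A` into `E` there are times along which the iterates at each point
of the `n`-th stage are close to the values of the maps at a nearby point of `A`. -/
theorem exists_times (h : CellSystem T a E P r) (hne : E.Nonempty) {A : Set X}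
    (g : Fin ℓ → ↥A → X) (hg : ∀ j x, g j x ∈ E) :
    ∃ p : ℕ → ℕ, StrictMono p ∧ (∀ n, 1 ≤ p n) ∧ ∃ δ : ℕ → ℝ, Tendsto δ atTop (𝓝 0) ∧
      ∀ k, ∀ᶠ n in atTop, ∀ z : ↥A, (z : X) ∈ limitSet E P r k →
        ∃ z' : ↥A, dist z z' < δ n ∧ ∀ j, dist (T^[a j (p n)] (z : X)) (g j z') < δ n := by
  classical
  obtain ⟨e, he⟩ := hne
  have hex : ∀ n, ∃ p, n < p ∧ ∀ z : ↥A, (z : X) ∈ stage P r (n + 1) → ∃ z' : ↥A,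
      dist z z' ≤ 2 * r (n + 1) ∧
        ∀ j, dist (T^[a j p] (z : X)) (g j z') < 2 * (1 / ((n : ℝ) + 1)) := by
    intro n
    let f : Fin ℓ → X → X := fun j x =>
      if hx : ∃ z : ↥A, (z : X) ∈ Metric.closedBall x (r (n + 1)) then g j hx.choose else e
    obtain ⟨p, hp, hpf⟩ := (h.refinement n).realize f (by
      intro i y _
      simp only [f]
      split_ifs
      · exact hg _ _
      · exact he)
    refine ⟨p, hp, fun z hz => ?_⟩
    obtain ⟨x, hx, hzx⟩ := mem_stage.1 hz
    have hxA : ∃ z : ↥A, (z : X) ∈ Metric.closedBall x (r (n + 1)) := ⟨z, hzx⟩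
    refine ⟨hxA.choose, ?_, fun j => ?_⟩
    · have h1 : dist (z : X) x ≤ r (n + 1) := hzx
      have h2 : dist (hxA.choose : X) x ≤ r (n + 1) := hxA.choose_spec
      rw [Subtype.dist_eq]
      linarith [dist_triangle_right (z : X) hxA.choose x]
    · simpa only [f, dif_pos hxA] using hpf j x hx z hzx
  choose p hp hpz using hex
  obtain ⟨φ, hφ, hpφ⟩ := strictMono_subseq_of_tendsto_atTop
    (tendsto_atTop_mono (fun n => (hp n).le) tendsto_id)
  have hlim : Tendsto (fun n : ℕ => 2 * r (n + 1) + 2 * (1 / ((n : ℝ) + 1))) atTop (𝓝 0) := by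
    simpa using ((h.tendsto_radius.comp (tendsto_add_atTop_nat 1)).const_mul 2).add
      ((tendsto_one_div_add_atTop_nhds_zero_nat (𝕜 := ℝ)).const_mul 2)
  refine ⟨p ∘ φ, hpφ, fun n => Nat.one_le_of_lt (hp (φ n)), _, hlim.comp hφ.tendsto_atTop, ?_⟩
  intro k
  filter_upwards [eventually_ge_atTop k] with n hn z hz
  obtain ⟨z', hzz', hz'⟩ := hpz (φ n) z
    (hz.2 _ (Nat.lt_succ_of_le (hn.trans (hφ.id_le n))))
  have hr := h.pos (φ n + 1)
  have hδ : (0 : ℝ) < 1 / ((φ n : ℝ) + 1) := by positivity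
  exact ⟨z', by simp only [Function.comp_apply]; linarith,
    fun j => (hz' j).trans (by simp only [Function.comp_apply]; linarith)⟩

theorem exists_pointwise_times (h : CellSystem T a E P r) (hne : E.Nonempty) {A : Set X}
    (hA : A ⊆ ⋃ k, limitSet E P r k) (g : Fin ℓ → ↥A → X) (hg : ∀ j x, g j x ∈ E)
    (hgc : ∀ j, Continuous (g j)) :
    ∃ p : ℕ → ℕ, StrictMono p ∧ (∀ n, 1 ≤ p n) ∧
      ∀ (x : ↥A) (j : Fin ℓ), Tendsto (fun n => T^[a j (p n)] (x : X)) atTop (𝓝 (g j x)) := by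
  obtain ⟨p, hp, hp1, δ, hδ, hpz⟩ := h.exists_times hne g hg
  refine ⟨p, hp, hp1, fun x j => ?_⟩
  obtain ⟨k, hk⟩ := Set.mem_iUnion.1 (hA x.2)
  rw [Metric.tendsto_atTop']
  intro ε hε
  obtain ⟨η, hη, hgη⟩ := Metric.continuous_iff.1 (hgc j) x (ε / 2) (half_pos hε)
  have hev : ∀ᶠ n in atTop, dist (T^[a j (p n)] (x : X)) (g j x) < ε := by
    filter_upwards [hpz k, hδ.eventually (gt_mem_nhds hη),
      hδ.eventually (gt_mem_nhds (half_pos hε))] with n hn h1 h2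
    obtain ⟨z', hz', hz'j⟩ := hn x hk
    have h3 := hgη z' (by rw [dist_comm]; exact hz'.trans h1)
    linarith [dist_triangle (T^[a j (p n)] (x : X)) (g j z') (g j x), hz'j j]
  obtain ⟨N, hN⟩ := eventually_atTop.1 hev
  exact ⟨N, fun n hn => hN n hn.le⟩

theorem exists_uniform_times [CompactSpace X]
    (h : CellSystem T a E P r) (hne : E.Nonempty) {k : ℕ} {B : Set X}
    (hBk : B ⊆ limitSet E P r k) (hB : IsClosed B) (g : Fin ℓ → ↥B → X)
    (hg : ∀ j x, g j x ∈ E) (hgc : ∀ j, Continuous (g j)) :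
    ∃ q : ℕ → ℕ, StrictMono q ∧ (∀ n, 1 ≤ q n) ∧
      ∀ ε : ℝ, 0 < ε → ∃ N : ℕ, ∀ n ≥ N, ∀ (x : ↥B) (j : Fin ℓ),
        dist (T^[a j (q n)] (x : X)) (g j x) < ε := by
  have : CompactSpace B := isCompact_iff_compactSpace.1 hB.isCompact
  obtain ⟨p, hp, hp1, δ, hδ, hpz⟩ := h.exists_times hne g hg
  refine ⟨p, hp, hp1, fun ε hε => eventually_atTop.1 ?_⟩
  have hu : UniformContinuous fun x j => g j x :=
    CompactSpace.uniformContinuous_of_continuous (continuous_pi hgc)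
  obtain ⟨η, hη, hgη⟩ := Metric.uniformContinuous_iff.1 hu (ε / 2) (half_pos hε)
  filter_upwards [hpz k, hδ.eventually (gt_mem_nhds hη),
    hδ.eventually (gt_mem_nhds (half_pos hε))] with n hn h1 h2 x j
  obtain ⟨z', hz', hz'j⟩ := hn x (hBk x.2)
  have h3 := (dist_le_pi_dist _ _ j).trans_lt (hgη (hz'.trans h1))
  rw [dist_comm] at h3
  linarith [dist_triangle (T^[a j (p n)] (x : X)) (g j z') (g j x), hz'j j]

end CellSystem

end Forward

/-- If `E` has a dense subset `C` without isolated points such that every map from a finite subset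
of `C` into `E` is a pointwise limit of iterates, then `E` is Δ-weakly mixing. -/
theorem deltaWeakMixAlong_of_finite_interpolation {ℓ : ℕ} {a : Fin ℓ → ℕ → ℕ} {X : Type*}
    [MetricSpace X] [CompactSpace X] {T : X → X} {E C : Set X} (hT : Continuous T) (hCE : C ⊆ E)
    (hC : Preperfect C) (hdense : E ⊆ closure C)
    (hint : ∀ A : Set X, A.Finite → A ⊆ C → ∀ g : Fin ℓ → ↥A → X, (∀ j x, g j x ∈ E) →
      ∃ p : ℕ → ℕ, (∀ n, 1 ≤ p n) ∧ ∀ (x : ↥A) (j : Fin ℓ),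
        Tendsto (fun n => T^[a j (p n)] (x : X)) atTop (𝓝 (g j x))) :
    DeltaWeakMixAlong T a E := by
  intro m _
  set Em : Set (Fin m → X) := {y | ∀ j, y j ∈ E}
  obtain ⟨b, hbc, -, hb⟩ := TopologicalSpace.exists_countable_basis (Fin ℓ → Fin m → X)
  let G (V : Set (Fin ℓ → Fin m → X)) : Set Em :=
    {x | ∃ n, 1 ≤ n ∧ (fun i j => T^[a i n] ((x : Fin m → X) j)) ∈ V}
  let b' := {V ∈ b | ∃ w ∈ V, ∀ i, w i ∈ Em}
  refine ⟨⋂ V ∈ b', G V, (countable_bInter_mem (hbc.mono (Set.sep_subset _ _))).2 ?_, ?_⟩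
  · rintro V ⟨hVb, w, hwV, hwE⟩
    have hV := hb.isOpen hVb
    refine residual_of_dense_open ?_ ?_
    · have : G V = ⋃ n, ⋃ (_ : 1 ≤ n),
          (fun (x : Em) i j => T^[a i n] ((x : Fin m → X) j)) ⁻¹' V := by
        ext; simp [G]
      rw [this]
      refine isOpen_iUnion fun n => isOpen_iUnion fun _ => hV.preimage ?_
      exact continuous_pi fun i => continuous_pi fun j =>
        (hT.iterate _).comp ((continuous_apply j).comp continuous_subtype_val)
    · rw [Metric.dense_iff]
      intro x ε hε
      have hinf : ∀ j, (Metric.ball ((x : Fin m → X) j) ε ∩ C).Infinite := fun j =>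
        hC.infinite_inter Metric.isOpen_ball <| by
          obtain ⟨z, hz, hxz⟩ := Metric.mem_closure_iff.1 (hdense (x.2 j)) ε hε
          exact ⟨z, by rwa [Metric.mem_ball'], hz⟩
      obtain ⟨y, hy, hyC⟩ := exists_injective_mem_of_infinite _ hinf
      let e := Equiv.ofInjective y hy
      obtain ⟨p, hp, hpt⟩ := hint (Set.range y) (Set.finite_range y)
        (Set.range_subset_iff.2 fun j => (hyC j).2) (fun i z => w i (e.symm z))
        (fun i z => hwE i _)
      have hlim : Tendsto (fun n i j => T^[a i (p n)] (y j)) atTop (𝓝 w) := by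
        refine tendsto_pi_nhds.2 fun i => tendsto_pi_nhds.2 fun j => ?_
        simpa [e] using hpt (e j) i
      obtain ⟨n, hn⟩ := (hlim.eventually (hV.mem_nhds hwV)).exists
      exact ⟨⟨y, fun j => hCE (hyC j).2⟩, (dist_pi_lt_iff hε).2 fun j => (hyC j).1,
        p n, hp n, hn⟩
  · intro x hx w hw
    rw [hb.mem_closure_iff]
    intro V hV hwV
    obtain ⟨n, hn, hnV⟩ := Set.mem_iInter₂.1 hx V ⟨hV, w, hwV, hw⟩
    exact ⟨_, hnV, n, hn, funext fun i => (iterate_comp_left_apply T _ _).symm⟩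

/-- Theorem: a closed subset `E` with at least two points is Δ-weakly mixing along
`Λ = {a₁,…,a_ℓ}` iff there is an increasing sequence of Cantor sets `C₁ ⊆ C₂ ⊆ ⋯` in `E`
whose union `C` is dense in `E` such that: (1) for any `A ⊆ C` and continuous
`g₁,…,g_ℓ : A → E` there is an increasing sequence `(p_n)` of positive integers with
`T^{a_j(p_n)}x → g_j(x)` for every `x ∈ A` and `j`; (2) for any `k`, any closed `B ⊆ C_k`
and continuous `h₁,…,h_ℓ : B → E` there is an increasing sequence `(q_n)` of positive
integers with `T^{a_j(q_n)}x → h_j(x)` uniformly in `x ∈ B` and `j`. -/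
theorem deltaWeakMixAlong_iff_cantor_approx
    {ℓ : ℕ} (hℓ : 1 ≤ ℓ) (a : Fin ℓ → ℕ → ℕ) (hpos : ∀ i n, 0 < a i n)
    {X : Type*} [MetricSpace X] [CompactSpace X] (T : X ≃ₜ X)
    (E : Set X) (hE : IsClosed E) (hnt : E.Nontrivial) :
    DeltaWeakMixAlong (⇑T) a E ↔
      ∃ C : ℕ → Set X, (∀ k, IsCantorSet (C k)) ∧ (∀ k, C k ⊆ C (k + 1)) ∧
        (∀ k, C k ⊆ E) ∧ (E ⊆ closure (⋃ k, C k)) ∧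
        (∀ A : Set X, A ⊆ (⋃ k, C k) →
          ∀ g : Fin ℓ → ↥A → X, (∀ j x, g j x ∈ E) → (∀ j, Continuous (g j)) →
            ∃ p : ℕ → ℕ, StrictMono p ∧ (∀ n, 1 ≤ p n) ∧
              ∀ (x : ↥A) (j : Fin ℓ),
                Tendsto (fun n => (⇑T)^[a j (p n)] (x : X)) atTop (𝓝 (g j x))) ∧
        (∀ k : ℕ, ∀ B : Set X, B ⊆ C k → IsClosed B →
          ∀ h : Fin ℓ → ↥B → X, (∀ j x, h j x ∈ E) → (∀ j, Continuous (h j)) →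
            ∃ q : ℕ → ℕ, StrictMono q ∧ (∀ n, 1 ≤ q n) ∧
              ∀ ε : ℝ, 0 < ε → ∃ N : ℕ, ∀ n ≥ N, ∀ (x : ↥B) (j : Fin ℓ),
                dist ((⇑T)^[a j (q n)] (x : X)) (h j x) < ε) := by
  constructor
  · intro hW
    obtain ⟨P, r, h⟩ := hW.exists_cellSystem T.continuous hℓ hE hnt
    exact ⟨CellSystem.limitSet E P r, h.isCantorSet_limitSet hE hnt.nonempty,
      fun k => CellSystem.limitSet_mono k.le_succ, fun k x hx => hx.1,
      h.subset_closure_iUnion_limitSet hE,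
      fun A hA g hg hgc => h.exists_pointwise_times hnt.nonempty hA g hg hgc,
      fun k B hBk hB g hg hgc => h.exists_uniform_times hnt.nonempty hBk hB g hg hgc⟩
  · rintro ⟨C, hC, -, hCE, hdense, hpt, -⟩
    refine deltaWeakMixAlong_of_finite_interpolation T.continuous (Set.iUnion_subset hCE) ?_
      hdense fun A hAf hA g hg => ?_
    · intro x hx
      obtain ⟨k, hk⟩ := Set.mem_iUnion.1 hx
      exact ((hC k).2.2.1.acc x hk).mono (principal_mono.2 (Set.subset_iUnion C k))
    · have := hAf.to_subtype
      obtain ⟨p, -, hp, hpt⟩ := hpt A hA g hg fun j => continuous_of_discreteTopology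
      exact ⟨p, hp, hpt⟩
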